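/- In the standard setup, let x be a vertex on C such that x and x⁺ both lie strictly between v⁺⁺ and v⁻⁻ along C. Then there do not exist vertices a, b ∈ (B⁺ ∩ B⁻) − {x, x⁺} (not necessarily distinct) with xa ∈ E(G) and x⁺b ∈ E(G). -/

import Mathlib

open scoped Classical

namespace Paper

noncomputable section

variable {V : Type*}

/-- degree as cardinality of neighbor set -/
def deg (G : SimpleGraph V) (x : V) : ℕ := (G.neighborSet x).ncard

/-- G is 1-tough -/
def OneTough (G : SimpleGraph V) : Prop :=
  ∀ S : Set V, S.Nonempty → Nat.card ((G.induce Sᶜ).ConnectedComponent) ≤ S.ncard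

def IsIndepTriple (G : SimpleGraph V) (s : Finset V) : Prop :=
  s.card = 3 ∧ ∀ x ∈ s, ∀ y ∈ s, x ≠ y → ¬ G.Adj x y

def sigma3 [Fintype V] (G : SimpleGraph V) : ℕ :=
  if ∃ s : Finset V, IsIndepTriple G s then
    sInf {k | ∃ s : Finset V, IsIndepTriple G s ∧ ∑ x ∈ s, deg G x = k}
  else 3 * (Fintype.card V - 1)

def NC2 [Fintype V] (G : SimpleGraph V) : ℕ :=
  if G = ⊤ then Fintype.card V - 1
  else sInf {k | ∃ x y : V, G.dist x y = 2 ∧ (G.neighborSet x ∪ G.neighborSet y).ncard = k}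

def circumference (G : SimpleGraph V) : ℕ :=
  sSup {k | ∃ (a : V) (w : G.Walk a a), w.IsCycle ∧ w.length = k}

def IsLongestCycle (G : SimpleGraph V) {a : V} (c : G.Walk a a) : Prop :=
  c.IsCycle ∧ ∀ (b : V) (w : G.Walk b b), w.IsCycle → w.length ≤ c.length

/-- successor of a vertex along the oriented cycle `c` (identity off the cycle) -/
def cSucc [DecidableEq V] {G : SimpleGraph V} {a : V} (c : G.Walk a a) (x : V) : V :=
  if h : x ∈ c.support.tail then c.support.tail.next x h else x

/-- predecessor of a vertex along the oriented cycle `c` (identity off the cycle) -/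
def cPred [DecidableEq V] {G : SimpleGraph V} {a : V} (c : G.Walk a a) (x : V) : V :=
  if h : x ∈ c.support.tail then c.support.tail.prev x h else x

/-- vertices strictly between `x` and `y` going forward along `c` -/
def arc [DecidableEq V] {G : SimpleGraph V} {a : V} (c : G.Walk a a) (x y : V) : Set V :=
  {z | ∃ i k : ℕ, 0 < i ∧ i < k ∧ k < c.length ∧ (cSucc c)^[k] x = y ∧ z = (cSucc c)^[i] x}

/-- length of the interval of the cycle `c` starting at `b` determined by `B` -/
def intervalLen [DecidableEq V] {G : SimpleGraph V} {a : V} (c : G.Walk a a)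
    (B : Set V) (b : V) : ℕ :=
  sInf {k | 0 < k ∧ (cSucc c)^[k] b ∈ B}

/-- inner vertices of the interval of the cycle `c` starting at `b` determined by `B` -/
def innerVerts [DecidableEq V] {G : SimpleGraph V} {a : V} (c : G.Walk a a)
    (B : Set V) (b : V) : Set V :=
  {x | ∃ i, 0 < i ∧ i < intervalLen c B b ∧ x = (cSucc c)^[i] b}

/-- the union of the neighborhoods of the vertices in `S` -/
def nbhdSet (G : SimpleGraph V) (S : Set V) : Set V := {z | ∃ y ∈ S, G.Adj y z}

/-- a set of vertices is independent -/
def IsIndepSet (G : SimpleGraph V) (S : Set V) : Prop :=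
  ∀ x ∈ S, ∀ y ∈ S, ¬ G.Adj x y

/-- the list `l` runs along a walk of `G` from `a` to `b` -/
structure Seg (G : SimpleGraph V) (l : List V) (a b : V) : Prop where
  isChain : l.IsChain G.Adj
  head : l.head? = some a
  last : l.getLast? = some b

namespace Seg

variable {G : SimpleGraph V} {l l' : List V} {a b c d : V}

theorem single (a : V) : Seg G [a] a a := ⟨by simp, by simp, by simp⟩

theorem append (s : Seg G l a b) (h : G.Adj b c) (t : Seg G l' c d) : Seg G (l ++ l') a d where
  isChain := s.isChain.append t.isChain (by simp [s.last, t.head, h])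
  head := by simp [s.head]
  last := by simp [t.last]

theorem reverse (s : Seg G l a b) : Seg G l.reverse b a where
  isChain := List.isChain_reverse.2 (by simpa only [G.adj_comm] using s.isChain)
  head := by simp [s.last]
  last := by simp [s.head]

theorem of_append (s : Seg G (l ++ l') a b) (hc : l.getLast? = some c) (hd : l'.head? = some d) :
    Seg G l a c ∧ G.Adj c d ∧ Seg G l' d b := by
  obtain ⟨h, ha, hb⟩ := s
  have h' := List.isChain_append.1 h
  refine ⟨⟨h'.1, ?_, hc⟩, h'.2.2 c hc d hd, ⟨h'.2.1, hd, ?_⟩⟩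
  · rcases l <;> simp_all
  · rcases List.eq_nil_or_concat l' with rfl | ⟨t, e, rfl⟩ <;> simp_all

theorem length_pos (s : Seg G l a b) : 0 < l.length := by
  rcases l with _ | _
  · simpa using s.head
  · simp

/-- A segment whose ends are adjacent closes up to a cycle. -/
theorem exists_isCycle (s : Seg G l a b) (h : G.Adj b a) (hl : l.Nodup) (hlen : 3 ≤ l.length) :
    ∃ w : G.Walk b b, w.IsCycle ∧ w.length = l.length := by
  obtain ⟨hc, ha, hb⟩ := s
  have hne : l ≠ [] := by rintro rfl; simp at ha
  obtain rfl : l.head hne = a := by simpa [List.head?_eq_some_head hne] using ha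
  obtain rfl : l.getLast hne = b := by simpa [List.getLast?_eq_some_getLast hne] using hb
  refine ⟨.cons h (.ofSupport l hne hc), ?_, by simp; omega⟩
  rw [SimpleGraph.Walk.isCycle_iff_isPath_tail_and_le_length]
  refine ⟨SimpleGraph.Walk.IsPath.mk' ?_, by simp; omega⟩
  simpa using hl

end Seg

/-- no ordering of the list `l` closes up to a cycle of `G` -/
def NoClosing (G : SimpleGraph V) (l : List V) : Prop :=
  ∀ l' a b, l'.Perm l → Seg G l' a b → ¬ G.Adj b a

/-- the vertices `z` and `m` are adjacent to both `u` and `v` -/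
structure Hub (G : SimpleGraph V) (u v z m : V) : Prop where
  zu : G.Adj z u
  zv : G.Adj z v
  mu : G.Adj m u
  mv : G.Adj m v

theorem Hub.swap {G : SimpleGraph V} {u v z m : V} (hub : Hub G u v z m) : Hub G v u z m :=
  ⟨hub.zv, hub.zu, hub.mv, hub.mu⟩

/-! The lemmas of this section exclude the possible orders of `x`, its successor `y` and the
vertices `p` and `q` along a path from `z` to `m`; the name of a lemma lists the vertices in
their order, and `h` is a path outside of the given one that starts in `u` or `v`. -/

namespace NoClosing

variable {G : SimpleGraph V} {u v z m x y p q p₁ p₂ q₁ q₂ e f : V} {l l' l₁ l₂ l₃ l₄ h h' : List V}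

theorem perm (no : NoClosing G l) (hp : l'.Perm l) : NoClosing G l' :=
  fun _ _ _ h => no _ _ _ (h.trans hp)

theorem x_p_q (no : NoClosing G (l₁ ++ l₂ ++ [p] ++ l₃ ++ [q] ++ l₄ ++ [u] ++ [v]))
    (hub : Hub G u v z m)
    (s₁ : Seg G l₁ z x) (s₂ : Seg G l₂ y p₁) (s₃ : Seg G l₃ p₂ q₁) (s₄ : Seg G l₄ q₂ m)
    (hp₂ : G.Adj p p₂) (hq₂ : G.Adj q q₂) (hx : G.Adj x p) (hy : G.Adj y q)
    (hp : G.Adj p₁ u ∨ G.Adj p₁ v) (hq : G.Adj q₁ u ∨ G.Adj q₁ v) : False := by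
  wlog hpu : G.Adj p₁ u generalizing u v
  · exact this (no.perm (by grind)) hub.swap hp.symm hq.symm (hp.resolve_left hpu)
  have s := (s₁.append hx (.single p)).append hp₂ s₃
  rcases hq with hq | hq
  · exact no _ _ _ (by grind) (((((s.append hq (.single u)).append hpu.symm s₂.reverse).append hy
      (.single q)).append hq₂ s₄).append hub.mv (.single v)) hub.zv.symm
  · exact no _ _ _ (by grind) (((((s.append hq (.single v)).append hub.mv.symm s₄.reverse).append
      hq₂.symm (.single q)).append hy.symm s₂).append hpu (.single u)) hub.zu.symm

theorem x_q_p (no : NoClosing G (l₁ ++ l₂ ++ [q] ++ l₃ ++ [p] ++ l₄ ++ [u] ++ [v]))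
    (hub : Hub G u v z m)
    (s₁ : Seg G l₁ z x) (s₂ : Seg G l₂ y q₁) (s₃ : Seg G l₃ q₂ p₁) (s₄ : Seg G l₄ p₂ m)
    (hq₂ : G.Adj q q₂) (hp₁ : G.Adj p₁ p) (hx : G.Adj x p) (hy : G.Adj y q)
    (hq : G.Adj q₁ u ∨ G.Adj q₁ v) (hp : G.Adj p₂ u ∨ G.Adj p₂ v) : False := by
  wlog hqu : G.Adj q₁ u generalizing u v
  · exact this (no.perm (by grind)) hub.swap hq.symm hp.symm (hq.resolve_left hqu)
  have s := (((((s₁.append hx (.single p)).append hp₁.symm s₃.reverse).append hq₂.symm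
    (.single q)).append hy.symm s₂).append hqu (.single u))
  rcases hp with hp | hp
  · exact no _ _ _ (by grind) ((s.append hp.symm s₄).append hub.mv (.single v)) hub.zv.symm
  · exact no _ _ _ (by grind) ((s.append hub.mu.symm s₄.reverse).append hp (.single v)) hub.zv.symm

theorem p_x_q (no : NoClosing G (l₁ ++ [p] ++ l₂ ++ l₃ ++ [q] ++ l₄ ++ [u] ++ [v]))
    (hub : Hub G u v z m)
    (s₁ : Seg G l₁ z p₁) (s₂ : Seg G l₂ p₂ x) (s₃ : Seg G l₃ y q₁) (s₄ : Seg G l₄ q₂ m)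
    (hp₁ : G.Adj p₁ p) (hq₂ : G.Adj q q₂) (hx : G.Adj x p) (hy : G.Adj y q)
    (hp : G.Adj p₂ u ∨ G.Adj p₂ v) (hq : G.Adj q₁ u ∨ G.Adj q₁ v) : False := by
  wlog hpu : G.Adj p₂ u generalizing u v
  · exact this (no.perm (by grind)) hub.swap hp.symm hq.symm (hp.resolve_left hpu)
  have s := ((s₁.append hp₁ (.single p)).append hx.symm s₂.reverse).append hpu (.single u)
  rcases hq with hq | hq
  · exact no _ _ _ (by grind) ((((s.append hq.symm s₃.reverse).append hy (.single q)).append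
      hq₂ s₄).append hub.mv (.single v)) hub.zv.symm
  · exact no _ _ _ (by grind) ((((s.append hub.mu.symm s₄.reverse).append hq₂.symm
      (.single q)).append hy.symm s₃).append hq (.single v)) hub.zv.symm

theorem q_x_p (no : NoClosing G (l₁ ++ [q] ++ l₂ ++ l₃ ++ [p] ++ l₄ ++ [u] ++ [v]))
    (hub : Hub G u v z m)
    (s₁ : Seg G l₁ z q₁) (s₂ : Seg G l₂ q₂ x) (s₃ : Seg G l₃ y p₁) (s₄ : Seg G l₄ p₂ m)
    (hq₁ : G.Adj q₁ q) (hp₁ : G.Adj p₁ p) (hx : G.Adj x p) (hy : G.Adj y q)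
    (hq : G.Adj q₂ u ∨ G.Adj q₂ v) (hp : G.Adj p₂ u ∨ G.Adj p₂ v) : False := by
  wlog hqu : G.Adj q₂ u generalizing u v
  · exact this (no.perm (by grind)) hub.swap hq.symm hp.symm (hq.resolve_left hqu)
  have s := ((((s₁.append hq₁ (.single q)).append hy.symm s₃).append hp₁ (.single p)).append
    hx.symm s₂.reverse).append hqu (.single u)
  rcases hp with hp | hp
  · exact no _ _ _ (by grind) ((s.append hp.symm s₄).append hub.mv (.single v)) hub.zv.symm
  · exact no _ _ _ (by grind) ((s.append hub.mu.symm s₄.reverse).append hp (.single v)) hub.zv.symm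

theorem x_p (no : NoClosing G (l₁ ++ l₂ ++ [p] ++ l₃ ++ [u] ++ [v])) (hub : Hub G u v z m)
    (s₁ : Seg G l₁ z x) (s₂ : Seg G l₂ y p₁) (s₃ : Seg G l₃ p₂ m)
    (hx : G.Adj x p) (hy : G.Adj y p)
    (hp₁ : G.Adj p₁ u ∨ G.Adj p₁ v) (hp₂ : G.Adj p₂ u ∨ G.Adj p₂ v) : False := by
  wlog hpu : G.Adj p₁ u generalizing u v
  · exact this (no.perm (by grind)) hub.swap hp₁.symm hp₂.symm (hp₁.resolve_left hpu)
  have s := ((s₁.append hx (.single p)).append hy.symm s₂).append hpu (.single u)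
  rcases hp₂ with hp | hp
  · exact no _ _ _ (by grind) ((s.append hp.symm s₃).append hub.mv (.single v)) hub.zv.symm
  · exact no _ _ _ (by grind) ((s.append hub.mu.symm s₃.reverse).append hp (.single v)) hub.zv.symm

theorem h_x_q (no : NoClosing G (l₁ ++ l₂ ++ [q] ++ l₃ ++ h ++ [v])) (hub : Hub G u v z m)
    (s₁ : Seg G l₁ z x) (s₂ : Seg G l₂ y q₁) (s₃ : Seg G l₃ q₂ m) (t : Seg G h u e)
    (hq₂ : G.Adj q q₂) (hx : G.Adj x e) (hy : G.Adj y q)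
    (hq : G.Adj q₁ u ∨ G.Adj q₁ v) : False := by
  have s := s₁.append hx t.reverse
  rcases hq with hq | hq
  · exact no _ _ _ (by grind) ((((s.append hq.symm s₂.reverse).append hy (.single q)).append
      hq₂ s₃).append hub.mv (.single v)) hub.zv.symm
  · exact no _ _ _ (by grind) ((((s.append hub.mu.symm s₃.reverse).append hq₂.symm
      (.single q)).append hy.symm s₂).append hq (.single v)) hub.zv.symm

theorem h_q_x (no : NoClosing G (l₁ ++ [q] ++ l₂ ++ l₃ ++ h ++ [v])) (hub : Hub G u v z m)
    (s₁ : Seg G l₁ z q₁) (s₂ : Seg G l₂ q₂ x) (s₃ : Seg G l₃ y m) (t : Seg G h u e)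
    (hq₂ : G.Adj q q₂) (hx : G.Adj x e) (hy : G.Adj y q)
    (hq : G.Adj q₁ u ∨ G.Adj q₁ v) : False := by
  rcases hq with hq | hq
  · exact no _ _ _ (by grind) (((((s₁.append hq t).append hx.symm s₂.reverse).append hq₂.symm
      (.single q)).append hy.symm s₃).append hub.mv (.single v)) hub.zv.symm
  · exact no _ _ _ (by grind) (((((s₁.append hq (.single v)).append hub.mv.symm s₃.reverse).append
      hy (.single q)).append hq₂ s₂).append hx t.reverse) hub.zu.symm

theorem h_x (no : NoClosing G (l₁ ++ l₂ ++ h ++ [v])) (hub : Hub G u v z m)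
    (s₁ : Seg G l₁ z x) (s₂ : Seg G l₂ y m) (t : Seg G h e f)
    (hx : G.Adj x e) (hy : G.Adj y f) : False :=
  no _ _ _ (by grind) (((s₁.append hx t).append hy.symm s₂).append hub.mv (.single v)) hub.zv.symm

theorem h_h_x (no : NoClosing G (l₁ ++ l₂ ++ h ++ h')) (hub : Hub G u v z m)
    (s₁ : Seg G l₁ z x) (s₂ : Seg G l₂ y m) (t : Seg G h u e) (t' : Seg G h' v f)
    (hx : G.Adj x e) (hy : G.Adj y f) : False :=
  no _ _ _ (by grind) (((s₁.append hx t.reverse).append hub.mu.symm s₂.reverse).append hy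
    t'.reverse) hub.zv.symm

end NoClosing


/-- The path `P` from `z` to `m` is joined to two further vertices `u` and `v` by its ends, and
no cycle has more than one vertex more than `P`. -/
structure Frame (G : SimpleGraph V) (u v z m : V) (P : List V) : Prop where
  seg : Seg G P z m
  hub : Hub G u v z m
  nodup : (P ++ [u] ++ [v]).Nodup
  length_le : ∀ l a b, Seg G l a b → G.Adj b a → l.Nodup → l.length ≤ P.length + 1

/-- `p` is not an end of the list `P`, and the elements before and after it are adjacent to `u`
or `v` -/
def Flanked (G : SimpleGraph V) (u v : V) (P : List V) (p : V) : Prop :=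
  ∀ S T, P = S ++ p :: T → (∃ w, S.getLast? = some w ∧ (G.Adj w u ∨ G.Adj w v)) ∧
    ∃ w, T.head? = some w ∧ (G.Adj w u ∨ G.Adj w v)

theorem Flanked.reverse {G : SimpleGraph V} {u v p : V} {P : List V} (hp : Flanked G u v P p) :
    Flanked G u v P.reverse p := by
  rintro S T h
  have := hp T.reverse S.reverse (by simpa using congrArg List.reverse h)
  simpa [and_comm] using this

/-- `p` is one of `u`, `v` or is off the list `P` and adjacent to `u` or `v` -/
def Hanging (G : SimpleGraph V) (u v : V) (P : List V) (p : V) : Prop :=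
  p = u ∨ p = v ∨ p ∉ P ∧ p ≠ u ∧ p ≠ v ∧ (G.Adj p u ∨ G.Adj p v)

theorem Hanging.exists_seg {G : SimpleGraph V} {u v p : V} {P : List V}
    (hp : Hanging G u v P p) (hP : (P ++ [u] ++ [v]).Nodup) :
    ∃ s t h, (s = u ∧ t = v ∨ s = v ∧ t = u) ∧ Seg G h s p ∧
      (P ++ h ++ [t]).Nodup := by
  rcases hp with rfl | rfl | ⟨hpP, hpu, hpv, h | h⟩
  · exact ⟨p, v, [p], by simp, .single p, hP⟩
  · exact ⟨p, u, [p], by simp, .single p, by grind⟩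
  · exact ⟨u, v, [u] ++ [p], by simp, (Seg.single u).append h.symm (.single p), by
      simp [List.nodup_append] at hP ⊢; grind⟩
  · exact ⟨v, u, [v] ++ [p], by simp, (Seg.single v).append h.symm (.single p), by
      simp [List.nodup_append] at hP ⊢; grind⟩

namespace Frame

variable {G : SimpleGraph V} {u v z m x y p q : V} {P l l₁ l₂ : List V}

theorem swap (F : Frame G u v z m P) : Frame G v u z m P :=
  ⟨F.seg, F.hub.swap, by have := F.nodup; grind, F.length_le⟩

theorem noClosing (F : Frame G u v z m P) (hl : l.Nodup) (h : P.length + 1 < l.length) :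
    NoClosing G l := fun l' a b hp s hab => by
  have := F.length_le l' a b s hab (hp.nodup_iff.2 hl)
  have := hp.length_eq
  omega

theorem hub_of (F : Frame G u v z m P) {s t : V} (h : s = u ∧ t = v ∨ s = v ∧ t = u) :
    Hub G s t z m := by
  rcases h with ⟨rfl, rfl⟩ | ⟨rfl, rfl⟩
  exacts [F.hub, F.hub.swap]

theorem not_adj (F : Frame G u v z m P) : ¬ G.Adj u v := fun h => by
  have := F.length_le _ _ _ ((F.seg.append F.hub.mu (.single u)).append h (.single v))
    F.hub.zv.symm F.nodup
  simp at this

/-- Consecutive vertices `x` and `y` of the path do not both have a hanging neighbor. -/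
theorem false_of_hanging (F : Frame G u v z m (l₁ ++ l₂)) (s₁ : Seg G l₁ z x) (s₂ : Seg G l₂ y m)
    (hx : G.Adj x p) (hy : G.Adj y q) (hp : Hanging G u v (l₁ ++ l₂) p)
    (hq : Hanging G u v (l₁ ++ l₂) q) : False := by
  have hd := F.nodup
  by_cases hpq : p = q
  · subst hpq
    obtain ⟨s, t, h, hst, hs, hn⟩ := hp.exists_seg hd
    have hph : p ∈ h := List.mem_of_getLast? hs.last
    have hn' : (l₁ ++ l₂ ++ [p] ++ [t]).Nodup :=
      hn.sublist (((List.singleton_sublist.2 hph).append_left _).append_right _)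
    exact NoClosing.h_x (F.noClosing hn' (by simp; omega)) (F.hub_of hst) s₁ s₂ (.single p) hx hy
  have same : ∀ {s t h}, Hub G s t z m → (l₁ ++ l₂ ++ h ++ [t]).Nodup → Seg G h p q → False :=
    fun hub hn hs => NoClosing.h_x (F.noClosing hn (by
      have := hs.length_pos
      simp; omega)) hub s₁ s₂ hs hx hy
  have diff : ∀ {s t h h'}, Hub G s t z m → (l₁ ++ l₂ ++ h ++ h').Nodup → Seg G h s p →
      Seg G h' t q → False := fun hub hn hs ht => NoClosing.h_h_x (F.noClosing hn (by
      have := hs.length_pos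
      have := ht.length_pos
      simp; omega)) hub s₁ s₂ hs ht hx hy
  wlog hpu : p = u ∨ p ≠ v ∧ G.Adj p u generalizing u v
  · exact this F.swap (by unfold Hanging at *; tauto) (by unfold Hanging at *; tauto) F.swap.nodup
      (by unfold Hanging at hp; tauto)
  have seg : ∀ {s w}, G.Adj w s → Seg G ([s] ++ [w]) s w :=
    fun h => (Seg.single _).append h.symm (.single _)
  rcases hpu with rfl | ⟨hpv, hpu⟩
  · rcases hq with rfl | rfl | ⟨hqP, hqu, hqv, h | h⟩
    · exact hpq rfl
    · exact diff F.hub hd (.single _) (.single _)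
    · exact same F.hub (by
        generalize l₁ ++ l₂ = P at *; clear same diff F
        simp [List.nodup_append] at hd hqP ⊢; grind) (seg h)
    · exact diff F.hub (by
        generalize l₁ ++ l₂ = P at *; clear same diff F
        simp [List.nodup_append] at hd hqP ⊢; grind) (.single _) (seg h)
  · have hpu' := hpu.ne
    have hpP : p ∉ l₁ ++ l₂ := by unfold Hanging at hp; tauto
    rcases hq with rfl | rfl | ⟨hqP, hqu, hqv, h | h⟩
    · exact same F.hub (by
        generalize l₁ ++ l₂ = P at *; clear same diff F
        simp [List.nodup_append] at hd hpP ⊢; grind) (seg hpu).reverse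
    · exact diff F.hub (by
        generalize l₁ ++ l₂ = P at *; clear same diff F
        simp [List.nodup_append] at hd hpP ⊢; grind) (seg hpu) (.single _)
    · exact same F.hub (by
        generalize l₁ ++ l₂ = P at *; clear same diff F
        simp [List.nodup_append] at hd hpP hqP ⊢; grind)
        ((seg hpu).reverse.append h.symm (.single q))
    · exact diff F.hub (by
        generalize l₁ ++ l₂ = P at *; clear same diff F
        simp [List.nodup_append] at hd hpP hqP ⊢; grind) (seg hpu) (seg h)

theorem not_adj_of_flanked (F : Frame G u v z m P) (hp : Flanked G u v P p) (hpP : p ∈ P) :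
    ¬ (G.Adj p u ∨ G.Adj p v) := fun h => by
  obtain ⟨S, T, rfl⟩ := List.append_of_mem hpP
  obtain ⟨⟨w, hw, h'⟩, -⟩ := hp S T rfl
  obtain ⟨s, -, t⟩ := F.seg.of_append hw (d := p) (by simp)
  have aux : ∀ {a}, G.Adj a u ∨ G.Adj a v →
      ∃ b, G.Adj a b ∧ Hanging G u v (S ++ p :: T) b := by
    rintro a (h | h)
    exacts [⟨u, h, .inl rfl⟩, ⟨v, h, .inr (.inl rfl)⟩]
  obtain ⟨b, hb, hb'⟩ := aux h'
  obtain ⟨c, hc, hc'⟩ := aux h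
  exact F.false_of_hanging s t hb hc hb' hc'

/-- A segment of the path splits at each flanked vertex that is not an end of it. -/
theorem split (F : Frame G u v z m P) (hP : P = l₁ ++ l ++ l₂) {a b : V} (s : Seg G l a b)
    (hp : Flanked G u v P p) (hpl : p ∈ l) (ha : p = z ∨ p ≠ a)
    (hb : p = m ∨ p ≠ b) :
    ∃ k₁ k₂ p₁ p₂, l = k₁ ++ p :: k₂ ∧ Seg G k₁ a p₁ ∧ G.Adj p₁ p ∧ G.Adj p p₂ ∧ Seg G k₂ p₂ b ∧
      (G.Adj p₁ u ∨ G.Adj p₁ v) ∧ (G.Adj p₂ u ∨ G.Adj p₂ v) := by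
  subst hP
  have hz : p ≠ z := by
    rintro rfl
    exact F.not_adj_of_flanked hp (by simp [hpl]) (.inl F.hub.zu)
  have hm : p ≠ m := by
    rintro rfl
    exact F.not_adj_of_flanked hp (by simp [hpl]) (.inl F.hub.mu)
  obtain ⟨k₁, k₂, rfl⟩ := List.append_of_mem hpl
  obtain ⟨⟨p₁, hp₁, h₁⟩, p₂, hp₂, h₂⟩ := hp (l₁ ++ k₁) (k₂ ++ l₂) (by simp)
  have hk₁ : k₁ ≠ [] := by
    rintro rfl
    have := s.head
    simp_all
  have hk₂ : k₂ ≠ [] := by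
    rintro rfl
    have := s.last
    simp_all
  rw [List.getLast?_append_of_ne_nil _ hk₁] at hp₁
  rw [List.head?_append_of_ne_nil _ hk₂] at hp₂
  obtain ⟨s₁, e₁, s'⟩ := s.of_append hp₁ (d := p) (by simp)
  obtain ⟨-, e₂, s₂⟩ := Seg.of_append (l := [p]) (c := p) s' (by simp) hp₂
  exact ⟨k₁, k₂, p₁, p₂, rfl, s₁, e₁, e₂, s₂, h₁, h₂⟩

theorem reverse (F : Frame G u v z m P) : Frame G u v m z P.reverse where
  seg := F.seg.reverse
  hub := ⟨F.hub.mu, F.hub.mv, F.hub.zu, F.hub.zv⟩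
  nodup := by simpa [List.nodup_append] using F.nodup
  length_le := by simpa using F.length_le

/-- One of the two outer neighbors hangs off the path, the other one lies on it. -/
theorem false_of_hanging_of_flanked (F : Frame G u v z m (l₁ ++ l₂)) (s₁ : Seg G l₁ z x)
    (s₂ : Seg G l₂ y m) (hx : G.Adj x p) (hy : G.Adj y q) (hp : Hanging G u v (l₁ ++ l₂) p)
    (hq : Flanked G u v (l₁ ++ l₂) q) (hqP : q ∈ l₁ ++ l₂) (hqx : q ≠ x) (hqy : q ≠ y) :
    False := by
  obtain ⟨s, t, h, hst, hs, hn⟩ := hp.exists_seg F.nodup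
  have hl := hs.length_pos
  have hub := F.hub_of hst
  have label : ∀ {w}, G.Adj w u ∨ G.Adj w v → G.Adj w s ∨ G.Adj w t := by
    rcases hst with ⟨rfl, rfl⟩ | ⟨rfl, rfl⟩
    exacts [id, Or.symm]
  rcases List.mem_append.1 hqP with hql | hql
  · obtain ⟨k₁, k₂, q₁, q₂, rfl, t₁, e₁, e₂, t₂, h₁, h₂⟩ :=
      F.split (l₁ := []) rfl s₁ hq hql (eq_or_ne _ _) (.inr hqx)
    exact NoClosing.h_q_x (l₁ := k₁) (q := q) (l₂ := k₂) (l₃ := l₂) (h := h)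
      (F.noClosing (by simpa using hn) (by simp; omega)) hub t₁ t₂ s₂ hs e₂ hx hy (label h₁)
  · obtain ⟨k₁, k₂, q₁, q₂, rfl, t₁, e₁, e₂, t₂, h₁, h₂⟩ :=
      F.split (l₂ := []) (List.append_nil _).symm s₂ hq hql (.inr hqy) (eq_or_ne _ _)
    exact NoClosing.h_x_q (l₁ := l₁) (l₂ := k₁) (q := q) (l₃ := k₂) (h := h)
      (F.noClosing (by simpa using hn) (by simp; omega)) hub s₁ t₁ t₂ hs e₂ hx hy (label h₁)

/-- Both outer neighbors lie on the path behind `x` and `y`. -/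
theorem false_of_mem_right (F : Frame G u v z m (l₁ ++ l₂)) (s₁ : Seg G l₁ z x)
    (s₂ : Seg G l₂ y m) (hx : G.Adj x p) (hy : G.Adj y q) (hp : Flanked G u v (l₁ ++ l₂) p)
    (hq : Flanked G u v (l₁ ++ l₂) q) (hpl : p ∈ l₂) (hql : q ∈ l₂) (hpy : p ≠ y) (hqy : q ≠ y) :
    False := by
  have hn := F.nodup
  have hq' := F.not_adj_of_flanked hq (by simp [hql])
  obtain ⟨k₁, k₂, p₁, p₂, rfl, t₁, e₁, e₂, t₂, h₁, h₂⟩ :=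
    F.split (l₂ := []) (List.append_nil _).symm s₂ hp hpl (.inr hpy) (eq_or_ne _ _)
  have hqp₁ : q ≠ p₁ := by rintro rfl; exact hq' h₁
  have hqp₂ : q ≠ p₂ := by rintro rfl; exact hq' h₂
  rcases List.mem_append.1 hql with hqk | hqk
  · obtain ⟨j₁, j₂, q₁, q₂, rfl, r₁, f₁, f₂, r₂, h₃, h₄⟩ :=
      F.split (l₁ := l₁) (l₂ := p :: k₂) (by simp) t₁ hq hqk (.inr hqy) (.inr hqp₁)
    exact NoClosing.x_q_p (F.noClosing (by simpa using hn) (by simp; omega)) F.hub s₁ r₁ r₂ t₂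
      f₂ e₁ hx hy h₃ h₂
  rcases List.mem_cons.1 hqk with rfl | hqk
  · exact NoClosing.x_p (F.noClosing (by simpa using hn) (by simp; omega)) F.hub s₁ t₁ t₂
      hx hy h₁ h₂
  · obtain ⟨j₁, j₂, q₁, q₂, rfl, r₁, f₁, f₂, r₂, h₃, h₄⟩ :=
      F.split (l₁ := l₁ ++ k₁ ++ [p]) (l₂ := []) (by simp) t₂ hq hqk (.inr hqp₂) (eq_or_ne _ _)
    exact NoClosing.x_p_q (F.noClosing (by simpa using hn) (by simp; omega)) F.hub s₁ t₁ r₁ r₂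
      e₂ f₂ hx hy h₁ h₃

/-- `x` and `y` lie between their outer neighbors, in either order. -/
theorem false_of_mem_of_mem (F : Frame G u v z m (l₁ ++ l₂)) (s₁ : Seg G l₁ z x)
    (s₂ : Seg G l₂ y m) (hx : G.Adj x p) (hy : G.Adj y q) (hp : Flanked G u v (l₁ ++ l₂) p)
    (hq : Flanked G u v (l₁ ++ l₂) q) (hpx : p ≠ x) (hpy : p ≠ y) (hqx : q ≠ x) (hqy : q ≠ y)
    (h : p ∈ l₁ ∧ q ∈ l₂ ∨ q ∈ l₁ ∧ p ∈ l₂) : False := by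
  have hn := F.nodup
  rcases h with ⟨hpl, hql⟩ | ⟨hql, hpl⟩
  · obtain ⟨k₁, k₂, p₁, p₂, rfl, t₁, e₁, e₂, t₂, h₁, h₂⟩ :=
      F.split (l₁ := []) rfl s₁ hp hpl (eq_or_ne _ _) (.inr hpx)
    obtain ⟨j₁, j₂, q₁, q₂, rfl, r₁, f₁, f₂, r₂, h₃, h₄⟩ :=
      F.split (l₂ := []) (List.append_nil _).symm s₂ hq hql (.inr hqy) (eq_or_ne _ _)
    exact NoClosing.p_x_q (F.noClosing (by simpa using hn) (by simp; omega)) F.hub t₁ t₂ r₁ r₂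
      e₁ f₂ hx hy h₂ h₃
  · obtain ⟨k₁, k₂, q₁, q₂, rfl, t₁, e₁, e₂, t₂, h₁, h₂⟩ :=
      F.split (l₁ := []) rfl s₁ hq hql (eq_or_ne _ _) (.inr hqx)
    obtain ⟨j₁, j₂, p₁, p₂, rfl, r₁, f₁, f₂, r₂, h₃, h₄⟩ :=
      F.split (l₂ := []) (List.append_nil _).symm s₂ hp hpl (.inr hpy) (eq_or_ne _ _)
    exact NoClosing.q_x_p (F.noClosing (by simpa using hn) (by simp; omega)) F.hub t₁ t₂ r₁ r₂
      e₁ f₁ hx hy h₂ h₄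

/-- Two consecutive vertices `x`, `y` of the path of a frame do not have
neighbors `p` and `q` (equal or not) outside `{x, y}` that hang off the path or are flanked on
it. -/
theorem false_of_flanked_or_hanging (F : Frame G u v z m (l₁ ++ l₂)) (s₁ : Seg G l₁ z x)
    (s₂ : Seg G l₂ y m) (hx : G.Adj x p) (hy : G.Adj y q)
    (hp : p ∈ l₁ ++ l₂ ∧ Flanked G u v (l₁ ++ l₂) p ∨ Hanging G u v (l₁ ++ l₂) p)
    (hq : q ∈ l₁ ++ l₂ ∧ Flanked G u v (l₁ ++ l₂) q ∨ Hanging G u v (l₁ ++ l₂) q)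
    (hpx : p ≠ x) (hpy : p ≠ y) (hqx : q ≠ x) (hqy : q ≠ y) : False := by
  have F' : Frame G u v m z (l₂.reverse ++ l₁.reverse) := by simpa using F.reverse
  have fl : ∀ {w}, Flanked G u v (l₁ ++ l₂) w → Flanked G u v (l₂.reverse ++ l₁.reverse) w := by
    intro w hw
    simpa using hw.reverse
  rcases hp with ⟨hpP, hp⟩ | hp <;> rcases hq with ⟨hqP, hq⟩ | hq
  · rcases List.mem_append.1 hpP with hpl | hpl <;> rcases List.mem_append.1 hqP with hql | hql
    · exact F'.false_of_mem_right s₂.reverse s₁.reverse hy hx (fl hq) (fl hp) (by simpa) (by simpa)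
        hqx hpx
    · exact F.false_of_mem_of_mem s₁ s₂ hx hy hp hq hpx hpy hqx hqy (.inl ⟨hpl, hql⟩)
    · exact F.false_of_mem_of_mem s₁ s₂ hx hy hp hq hpx hpy hqx hqy (.inr ⟨hql, hpl⟩)
    · exact F.false_of_mem_right s₁ s₂ hx hy hp hq hpl hql hpy hqy
  · refine F'.false_of_hanging_of_flanked s₂.reverse s₁.reverse hy hx ?_ (fl hp)
      (by simpa [or_comm] using hpP) hpy hpx
    simpa [Hanging, and_comm] using hq
  · exact F.false_of_hanging_of_flanked s₁ s₂ hx hy hp hq hqP hqx hqy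
  · exact F.false_of_hanging s₁ s₂ hx hy hp hq

end Frame

/-! A longest cycle through `v` is cut at `v` into the path of a frame. -/

theorem isRotated_cons_cons_of_append {L S T : List V} {v w : V} (h : L ~r S ++ v :: w :: T) :
    L ~r v :: w :: (T ++ S) :=
  h.trans (by simpa using List.isRotated_append (l := S) (l' := v :: w :: T))

theorem isRotated_last_cons {L S : List V} {v w : V} (h : L ~r v :: (S ++ [w])) :
    L ~r w :: v :: S :=
  h.trans (by simpa using List.isRotated_append (l := v :: S) (l' := [w]))

section Cycle

open SimpleGraph

variable [DecidableEq V] {G : SimpleGraph V} {a u v w x : V} {c : G.Walk a a} {P S T : List V}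

theorem cSucc_of_isRotated (hc : c.IsCycle) (h : c.support.tail ~r v :: w :: T) :
    cSucc c v = w := by
  have hv : v ∈ c.support.tail := h.mem_iff.2 (by simp)
  rw [cSucc, dif_pos hv, List.isRotated_next_eq h hc.support_nodup hv, List.next_cons_cons_eq]

theorem cPred_cSucc (hc : c.IsCycle) (x : V) : cPred c (cSucc c x) = x := by
  unfold cSucc cPred
  split_ifs with hx hx'
  · exact List.prev_next _ hc.support_nodup x hx
  · exact absurd (List.next_mem _ x hx) hx'
  · rfl

theorem cSucc_cPred (hc : c.IsCycle) (x : V) : cSucc c (cPred c x) = x := by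
  unfold cSucc cPred
  split_ifs with hx hx'
  · exact List.next_prev _ hc.support_nodup x hx
  · exact absurd (List.prev_mem _ x hx) hx'
  · rfl

theorem cPred_of_isRotated (hc : c.IsCycle) (h : c.support.tail ~r v :: w :: T) :
    cPred c w = v := by
  rw [← cSucc_of_isRotated hc h, cPred_cSucc hc]

theorem iterate_cSucc_eq_getElem (hc : c.IsCycle) (h : c.support.tail ~r v :: P) (k : ℕ)
    (hk : k < (v :: P).length) : (cSucc c)^[k] v = (v :: P)[k] := by
  induction k with
  | zero => rfl
  | succ k ih =>
    rw [Function.iterate_succ_apply', ih (by omega)]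
    refine cSucc_of_isRotated hc (isRotated_cons_cons_of_append (S := (v :: P).take k)
      (T := (v :: P).drop (k + 2)) ?_)
    rwa [List.getElem_cons_drop, List.getElem_cons_drop, List.take_append_drop]

theorem mem_of_mem_arc (hc : c.IsCycle) (h : c.support.tail ~r v :: P)
    (hx : x ∈ arc c (cSucc c v) (cPred c v)) : x ∈ P := by
  obtain ⟨i, k, hi, hik, hk, -, rfl⟩ := hx
  have hlen : c.length = P.length + 1 := by
    simpa using h.perm.length_eq
  rw [← Function.iterate_succ_apply, iterate_cSucc_eq_getElem hc h _ (by simp; omega)]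
  simp

/-- The rest of a longest cycle, from the successor of `v` to its predecessor, is framed. -/
theorem IsLongestCycle.exists_frame (hc : IsLongestCycle G c) (hu : u ∉ c.support)
    (hv : v ∈ c.support) (huv1 : G.Adj u (cSucc c v)) (huv2 : G.Adj u (cPred c v)) :
    ∃ P, c.support.tail ~r v :: P ∧ Frame G u v (cSucc c v) (cPred c v) P := by
  have hcyc := hc.1
  have hrot := (c.support_rotate v hv).symm
  have hne : (c.rotate _ hv).support.tail ≠ [] := by
    have := hcyc.three_le_length
    intro h0
    have := hrot.perm.length_eq
    rw [h0, List.length_tail, Walk.length_support, List.length_nil] at this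
    omega
  obtain ⟨P, t, hP⟩ := List.eq_nil_or_concat' (c.rotate _ hv).support.tail |>.resolve_left hne
  obtain rfl : t = v := by
    have := congrArg List.getLast? (c.rotate _ hv).cons_tail_support
    rw [hP, List.getLast?_eq_some_getLast (Walk.support_ne_nil _), Walk.getLast_support] at this
    simpa [List.getLast?_cons] using this
  have h : c.support.tail ~r t :: P :=
    hrot.trans (by rw [hP]; simpa using List.isRotated_append (l := P) (l' := [t]))
  have hlen : c.length = P.length + 1 := by simpa using h.perm.length_eq
  have h3 := hcyc.three_le_length
  have hchain : (t :: (P ++ [t])).IsChain G.Adj := by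
    have := (c.rotate _ hv).isChain_adj_support
    rwa [← Walk.cons_tail_support, hP] at this
  have hnd : (t :: P).Nodup := h.nodup_iff.1 hcyc.support_nodup
  obtain ⟨z, hz⟩ : ∃ z, P.head? = some z := by
    rcases P with _ | ⟨z, _⟩
    · simp at hlen; omega
    · exact ⟨z, rfl⟩
  obtain ⟨m, hm⟩ : ∃ m, P.getLast? = some m := by
    rcases List.eq_nil_or_concat' P with rfl | ⟨_, m, rfl⟩
    · simp at hlen; omega
    · exact ⟨m, by simp⟩
  have hcz : cSucc c t = z := by
    obtain ⟨T, rfl⟩ := List.head?_eq_some_iff.1 hz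
    exact cSucc_of_isRotated hcyc h
  have hcm : cPred c t = m := by
    obtain ⟨T, rfl⟩ := List.getLast?_eq_some_iff.1 hm
    exact cPred_of_isRotated hcyc (isRotated_last_cons h)
  rw [hcz] at huv1 ⊢
  rw [hcm] at huv2 ⊢
  have s : Seg G ([t] ++ (P ++ [t])) t t := ⟨hchain, rfl, by simp [List.getLast?_cons]⟩
  obtain ⟨-, htz, s⟩ := s.of_append (c := t) (d := z) rfl (by simp [hz])
  obtain ⟨s, hmt, -⟩ := s.of_append (d := t) hm rfl
  have hu' : u ∉ t :: P := fun hmem => hu (List.mem_of_mem_tail (h.mem_iff.2 hmem))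
  refine ⟨P, h, s, ⟨huv1.symm, htz.symm, huv2.symm, hmt⟩, ?_, ?_⟩
  · simp [List.nodup_append] at hnd hu' ⊢
    grind
  · intro l b d sl hdb hl
    by_contra! hlt
    obtain ⟨w, hw, hwl⟩ := sl.exists_isCycle hdb hl (by omega)
    have := hc.2 _ w hw
    omega

theorem Frame.flanked_or_hanging {z m p : V} {B : Set V} (F : Frame G u v z m P)
    (hc : c.IsCycle) (h : c.support.tail ~r v :: P)
    (hB : B = G.neighborSet u ∪ G.neighborSet v) (hp : p ∈ (cSucc c '' B) ∩ (cPred c '' B)) :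
    p ∈ P ∧ Flanked G u v P p ∨ Hanging G u v P p := by
  have hB' : ∀ {w}, w ∈ B → G.Adj w u ∨ G.Adj w v := by
    intro w hw
    simpa [hB, G.adj_comm w] using hw
  have hvB : v ∉ B := fun hv => F.not_adj (by simpa [G.adj_comm] using hB' hv)
  obtain ⟨hpred, hsucc⟩ : cPred c p ∈ B ∧ cSucc c p ∈ B := by
    obtain ⟨⟨b, hb, rfl⟩, ⟨d, hd, hdb⟩⟩ := hp
    refine ⟨by rwa [cPred_cSucc hc], ?_⟩
    rwa [← hdb, cSucc_cPred hc]
  by_cases hpP : p ∈ P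
  · refine .inl ⟨hpP, fun S T hST => ⟨?_, ?_⟩⟩
    · rcases List.eq_nil_or_concat' S with rfl | ⟨S, w, rfl⟩
      · rw [cPred_of_isRotated hc (by simpa [hST] using h)] at hpred
        exact absurd hpred hvB
      · refine ⟨w, by simp, hB' ?_⟩
        rwa [cPred_of_isRotated hc (isRotated_cons_cons_of_append (S := v :: S) (T := T)
          (by simpa [hST] using h))] at hpred
    · rcases T with _ | ⟨w, T⟩
      · rw [cSucc_of_isRotated hc (isRotated_last_cons (by simpa [hST] using h))] at hsucc
        exact absurd hsucc hvB
      · refine ⟨w, by simp, hB' ?_⟩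
        rwa [cSucc_of_isRotated hc (isRotated_cons_cons_of_append (S := v :: S) (T := T)
          (by simpa [hST] using h))] at hsucc
  · right
    by_cases hpv : p = v
    · exact .inr (.inl hpv)
    have : p ∉ c.support.tail := fun hmem => by
      have := h.mem_iff.1 hmem
      simp_all
    rw [cSucc, dif_neg this] at hsucc
    by_cases hpu : p = u
    · exact .inl hpu
    · exact .inr (.inr ⟨hpP, hpu, hpv, hB' hsucc⟩)

end Cycle

theorem stmt14 {V : Type*} [Fintype V] [DecidableEq V] (G : SimpleGraph V)
    (hn : 3 ≤ Fintype.card V) (htough : OneTough G) (hsig : Fintype.card V ≤ sigma3 G)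
    (hham : ¬ G.IsHamiltonian) {a : V} (c : G.Walk a a) (hc : IsLongestCycle G c)
    (u v : V) (hu : u ∉ c.support) (hv : v ∈ c.support)
    (huv1 : G.Adj u (cSucc c v)) (huv2 : G.Adj u (cPred c v))
    (B : Set V) (hB : B = G.neighborSet u ∪ G.neighborSet v)
    (x : V) (hx : x ∈ arc c (cSucc c v) (cPred c v))
    (hx' : cSucc c x ∈ arc c (cSucc c v) (cPred c v)) :
    ¬ ∃ p q : V, p ∈ (cSucc c '' B) ∩ (cPred c '' B) ∧ q ∈ (cSucc c '' B) ∩ (cPred c '' B) ∧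
      p ≠ x ∧ p ≠ cSucc c x ∧ q ≠ x ∧ q ≠ cSucc c x ∧
      G.Adj x p ∧ G.Adj (cSucc c x) q := by
  rintro ⟨p, q, hp, hq, hpx, hpy, hqx, hqy, hxp, hyq⟩
  obtain ⟨P, hrot, F⟩ := hc.exists_frame hu hv huv1 huv2
  have hxP := mem_of_mem_arc hc.1 hrot hx
  have hyP := mem_of_mem_arc hc.1 hrot hx'
  have hp' := F.flanked_or_hanging hc.1 hrot hB hp
  have hq' := F.flanked_or_hanging hc.1 hrot hB hq
  obtain ⟨S, T, rfl⟩ := List.append_of_mem hxP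
  rcases T with _ | ⟨y, T⟩
  · rw [cSucc_of_isRotated hc.1 (isRotated_last_cons hrot)] at hyP
    have := hrot.nodup_iff.1 hc.1.support_nodup
    simp_all
  · have hxy : cSucc c x = y :=
      cSucc_of_isRotated hc.1 (isRotated_cons_cons_of_append (S := v :: S) hrot)
    rw [hxy] at hpy hqy hyq
    have hP : S ++ x :: y :: T = (S ++ [x]) ++ (y :: T) := by simp
    rw [hP] at F hp' hq'
    obtain ⟨s₁, -, s₂⟩ := F.seg.of_append (c := x) (d := y) (by simp) rfl
    exact F.false_of_flanked_or_hanging s₁ s₂ hxp hyq hp' hq' hpx hpy hqx hqy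


end
end Paper
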